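/- arXiv:2505.23274 — 5 statements merged into one kernel-verified Lean document; each statement's English description precedes it below -/
import Mathlib

section
/- For each 0 ≤ i ≤ s let σ_{j_i} be an integer with σ_{j_i}·λ_{j_i} ≡ 1 (mod m). Then a tuple (a_0, a_1, …, a_s) of nonnegative integers is an arithmetic pure gap at (j_0, …, j_s) if and only if for every 0 ≤ k ≤ s one has ∑_{i=0}^{s} ⌊(a_i − a_k·σ_{j_k}·λ_{j_i})/m⌋ + ∑_{i=s+1}^{r} ⌊(−a_k·σ_{j_k}·λ_{j_i})/m⌋ ≤ −1. -/
open Finset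

/-- Floor of the rational number `x / m`. -/
noncomputable def fdivq (m : ℕ) (x : ℤ) : ℤ := ⌊(x : ℚ) / (m : ℚ)⌋

/-- The quantity `∑_{i=0}^{n-1} ⌊(a_i + t·λ_{c i})/m⌋ + ∑_{w ∉ range c} ⌊t·λ_w/m⌋`. -/
noncomputable def gapSum (m r n : ℕ) (lam : Fin (r + 1) → ℤ)
    (c : Fin n → Fin (r + 1)) (a : Fin n → ℤ) (t : ℤ) : ℤ :=
  (∑ i : Fin n, fdivq m (a i + t * lam (c i))) +
    ∑ w ∈ Finset.univ \ Finset.image c Finset.univ, fdivq m (t * lam w)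

/-- `(a 0, …, a (n-1))` is an *arithmetic pure gap* at the (pairwise distinct) indices
`c 0, …, c (n-1)` of `{0,…,r}`: the entries are nonnegative and for every
`t ∈ {0,…,m-1}` exactly one of the two Bartoli–Quoos–Zini conditions holds. -/
noncomputable def IsArithPureGap (m r n : ℕ) (lam : Fin (r + 1) → ℤ)
    (c : Fin n → Fin (r + 1)) (a : Fin n → ℤ) : Prop :=
  (∀ i, 0 ≤ a i) ∧
    ∀ t : ℤ, 0 ≤ t → t ≤ (m : ℤ) - 1 →
      Xor' (gapSum m r n lam c a t < 0)
        (0 ≤ gapSum m r n lam c a t ∧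
          ∀ i : Fin n, fdivq m (a i + t * lam (c i)) = fdivq m (a i + t * lam (c i) - 1))

/-- The rational floor `fdivq` is Euclidean division of integers. -/
lemma fdivq_eq_ediv (m : ℕ) (x : ℤ) : fdivq m x = x / (m : ℤ) :=
  Rat.floor_intCast_div_natCast x m

lemma fdivq_add_mul {m : ℕ} (hm : m ≠ 0) (x q : ℤ) :
    fdivq m (x + (m : ℤ) * q) = fdivq m x + q := by
  simp only [fdivq_eq_ediv]
  exact Int.add_mul_ediv_left x q (by exact_mod_cast hm)

lemma fdivq_eq_fdivq_sub_one_iff {m : ℕ} (hm : m ≠ 0) (x : ℤ) :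
    fdivq m x = fdivq m (x - 1) ↔ ¬ (m : ℤ) ∣ x := by
  have hm' : (0 : ℤ) < m := by exact_mod_cast Nat.pos_of_ne_zero hm
  simp only [fdivq_eq_ediv]
  constructor
  · rintro h ⟨q, rfl⟩
    have hlt : ((m : ℤ) * q - 1) / m < q := by
      rw [Int.ediv_lt_iff_lt_mul hm']
      linarith [mul_comm (m : ℤ) q]
    rw [Int.mul_ediv_cancel_left q hm'.ne'] at h
    omega
  · intro h
    have hne : x % m ≠ 0 := fun h0 => h (Int.dvd_of_emod_eq_zero h0)
    have hnonneg := Int.emod_nonneg x hm'.ne'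
    have hlt := Int.emod_lt_of_pos x hm'
    have hdecomp : x - 1 = (x % m - 1) + m * (x / m) := by
      linarith [Int.emod_add_mul_ediv x m]
    have hzero : (x % m - 1) / (m : ℤ) = 0 := Int.ediv_eq_zero_of_lt (by omega) (by omega)
    rw [hdecomp, Int.add_mul_ediv_left _ _ hm'.ne', hzero, zero_add]

/-- `gapSum` is `m`-periodic in `t` when the exponents `lam` sum to zero. -/
lemma gapSum_congr {m r n : ℕ} (hm : m ≠ 0) {lam : Fin (r + 1) → ℤ}
    (hsum : ∑ i, lam i = 0) {c : Fin n → Fin (r + 1)} (hc : Function.Injective c)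
    (a : Fin n → ℤ) {t u : ℤ} (h : u ≡ t [ZMOD m]) :
    gapSum m r n lam c a t = gapSum m r n lam c a u := by
  obtain ⟨q, hq⟩ := h.dvd
  obtain rfl : t = u + m * q := by linarith
  have hshift : ∀ x l : ℤ, fdivq m (x + (u + m * q) * l) = fdivq m (x + u * l) + q * l := by
    intro x l
    rw [← fdivq_add_mul hm]
    ring_nf
  have hsplit : ∑ i, lam (c i) + ∑ w ∈ Finset.univ \ Finset.image c Finset.univ, lam w = 0 := by
    rw [← hsum, ← Finset.sum_sdiff (Finset.subset_univ (Finset.image c Finset.univ)),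
      Finset.sum_image hc.injOn, add_comm]
  have hshift₀ : ∀ l : ℤ, fdivq m ((u + m * q) * l) = fdivq m (u * l) + q * l := by
    intro l
    simpa using hshift 0 l
  simp only [gapSum, hshift, hshift₀, Finset.sum_add_distrib, ← Finset.mul_sum]
  linear_combination q * hsplit

/-- If `σ` inverts `l` modulo `m`, then `m ∣ a + t * l` exactly when `t ≡ -(a * σ)`. -/
lemma dvd_add_mul_iff_modEq {m σ l : ℤ} (hσ : σ * l ≡ 1 [ZMOD m]) (a t : ℤ) :
    m ∣ a + t * l ↔ t ≡ -(a * σ) [ZMOD m] := by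
  obtain ⟨d, hd⟩ := hσ.dvd
  rw [Int.modEq_comm, Int.modEq_iff_dvd]
  constructor
  · rintro ⟨e, he⟩
    exact ⟨e * σ + t * d, by linear_combination σ * he + t * hd⟩
  · rintro ⟨e, he⟩
    exact ⟨e * l + a * d, by linear_combination l * he + a * hd⟩

/-- Criterion for arithmetic pure gaps at `s+1` totally ramified places
(Lemma 3.3 / "simple criterion"). -/
theorem pureGap_iff_criterion (m r : ℕ) (hm : 2 ≤ m) (hr : 1 ≤ r)
    (lam : Fin (r + 1) → ℤ) (hlam : ∀ i, lam i ≠ 0) (hsum : ∑ i, lam i = 0)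
    (s : ℕ) (hsr : s ≤ r) (perm : Equiv.Perm (Fin (r + 1)))
    (c : Fin (s + 1) → Fin (r + 1))
    (hc : ∀ i, c i = perm (Fin.castLE (Nat.succ_le_succ hsr) i))
    (hgcd : ∀ i, Int.gcd (m : ℤ) (lam (c i)) = 1)
    (σ : Fin (s + 1) → ℤ)
    (hσ : ∀ i, Int.ModEq (m : ℤ) (σ i * lam (c i)) 1)
    (a : Fin (s + 1) → ℤ) (ha : ∀ i, 0 ≤ a i) :
    IsArithPureGap m r (s + 1) lam c a ↔
      ∀ k : Fin (s + 1),
        (∑ i : Fin (s + 1), fdivq m (a i - a k * σ k * lam (c i))) +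
            (∑ w ∈ Finset.univ \ Finset.image c Finset.univ,
              fdivq m (-(a k * σ k) * lam w)) ≤ -1 := by
  have hm0 : m ≠ 0 := by omega
  have hmpos : (0 : ℤ) < m := by exact_mod_cast Nat.pos_of_ne_zero hm0
  have hinj : Function.Injective c := fun i j hij => by
    rw [hc, hc] at hij
    exact Fin.castLE_injective _ (perm.injective hij)
  have hcrit : ∀ k : Fin (s + 1),
      (∑ i : Fin (s + 1), fdivq m (a i - a k * σ k * lam (c i))) +
        (∑ w ∈ Finset.univ \ Finset.image c Finset.univ,
          fdivq m (-(a k * σ k) * lam w)) =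
        gapSum m r (s + 1) lam c a (-(a k * σ k)) := by
    intro k
    simp only [gapSum, neg_mul, sub_eq_add_neg]
  simp only [hcrit, IsArithPureGap, fdivq_eq_fdivq_sub_one_iff hm0,
    dvd_add_mul_iff_modEq (hσ _)]
  constructor
  · rintro ⟨-, h⟩ k
    have hmod : -(a k * σ k) % m ≡ -(a k * σ k) [ZMOD m] := Int.mod_modEq _ _
    have hlt := Int.emod_lt_of_pos (-(a k * σ k)) hmpos
    rw [gapSum_congr hm0 hsum hinj a hmod]
    rcases h _ (Int.emod_nonneg (-(a k * σ k)) hmpos.ne') (by omega) with ⟨hneg, -⟩ | ⟨⟨-, hnot⟩, -⟩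
    · omega
    · exact absurd hmod (hnot k)
  · refine fun h => ⟨ha, fun t _ _ => ?_⟩
    rcases lt_or_ge (gapSum m r (s + 1) lam c a t) 0 with hneg | hnonneg
    · exact Or.inl ⟨hneg, fun hii => hneg.not_ge hii.1⟩
    · refine Or.inr ⟨⟨hnonneg, fun k hk => ?_⟩, hnonneg.not_gt⟩
      have := h k
      rw [gapSum_congr hm0 hsum hinj a hk] at this
      omega
end

section
/- Let m ≥ 2 and r ≥ 1 be integers with gcd(m, r) = 1, let k be an integer with 1 ≤ k ≤ 2r−1, and let j be an integer with 1−m ≤ j ≤ m−1. If k ≠ r, then ⌊r·j/m⌋ ≤ r−k−1 if and only if j ≤ m − ⌈k·m/r⌉; if k = r, then ⌊r·j/m⌋ ≤ r−k−1 if and only if j ≤ m − ⌈k·m/r⌉ − 1. -/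
/-- A floor bound on a quotient of integers, with denominators cleared. -/
theorem floor_mul_div_le_sub_one_iff {m : ℕ} (hm : 0 < m) (a b c : ℤ) :
    ⌊((a : ℚ) * (b : ℚ)) / (m : ℚ)⌋ ≤ c - 1 ↔ a * b < c * m := by
  have hm' : (0 : ℚ) < m := by exact_mod_cast hm
  rw [Int.le_sub_one_iff, Int.floor_lt, div_lt_iff₀ hm']
  norm_cast

/-- A ceiling bound on a quotient of integers, with denominators cleared. -/
theorem ceil_mul_div_le_iff {r : ℕ} (hr : 0 < r) (a b c : ℤ) :
    ⌈((a : ℚ) * (b : ℚ)) / (r : ℚ)⌉ ≤ c ↔ a * b ≤ c * r := by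
  have hr' : (0 : ℚ) < r := by exact_mod_cast hr
  rw [Int.ceil_le, div_le_iff₀ hr']
  norm_cast


/-- Lemma on floors and ceilings: for `gcd(m,r) = 1`, `1 ≤ k ≤ 2r−1`, `1−m ≤ j ≤ m−1`:
if `k ≠ r` then `⌊rj/m⌋ ≤ r−k−1 ↔ j ≤ m − ⌈km/r⌉`, and
if `k = r` then `⌊rj/m⌋ ≤ r−k−1 ↔ j ≤ m − ⌈km/r⌉ − 1`. -/
theorem floor_le_iff_le_sub_ceil (m r : ℕ) (hm : 2 ≤ m) (hr : 1 ≤ r)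
    (hcop : Nat.Coprime m r) (k j : ℤ)
    (hk1 : 1 ≤ k) (hk2 : k ≤ 2 * (r : ℤ) - 1)
    (hj1 : 1 - (m : ℤ) ≤ j) (hj2 : j ≤ (m : ℤ) - 1) :
    (k ≠ (r : ℤ) →
      (⌊((r : ℚ) * (j : ℚ)) / (m : ℚ)⌋ ≤ (r : ℤ) - k - 1 ↔
        j ≤ (m : ℤ) - ⌈((k : ℚ) * (m : ℚ)) / (r : ℚ)⌉)) ∧
    (k = (r : ℤ) →
      (⌊((r : ℚ) * (j : ℚ)) / (m : ℚ)⌋ ≤ (r : ℤ) - k - 1 ↔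
        j ≤ (m : ℤ) - ⌈((k : ℚ) * (m : ℚ)) / (r : ℚ)⌉ - 1)) := by
  have hfloor := floor_mul_div_le_sub_one_iff (m := m) (by omega) r j (r - k)
  have hceil := ceil_mul_div_le_iff (r := r) (by omega) k m
  simp only [Int.cast_natCast] at hfloor hceil
  have hr0 : (0 : ℤ) < r := by exact_mod_cast hr
  rw [hfloor]
  refine ⟨fun hk => ?_, fun hk => ?_⟩
  · rw [le_sub_comm, hceil]
    have hne : (r : ℤ) * j ≠ (r - k) * m := by
      intro h
      have hdvd : (r : ℤ) ∣ k * m := ⟨m - j, by linear_combination h⟩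
      obtain ⟨c, rfl⟩ :=
        (Nat.isCoprime_iff_coprime.mpr hcop.symm).dvd_of_dvd_mul_right hdvd
      have hc0 : 0 < c := by nlinarith
      have hc2 : c < 2 := by nlinarith
      obtain rfl : c = 1 := by omega
      exact hk (mul_one _)
    rw [← hne.le_iff_lt]
    constructor <;> intro h <;> linarith
  · subst hk
    rw [sub_right_comm, le_sub_comm, hceil]
    rw [sub_self, zero_mul, mul_comm (r : ℤ) m, mul_le_mul_iff_left₀ hr0,
      ← smul_eq_mul, smul_neg_iff_of_pos_left hr0]
    omega
end

section
/- Let m ≥ 2 and r ≥ 1 be integers with gcd(m, r) = 1. Then the following two sets of integers are equal: { m·k + j : k, j ∈ ℤ, 1 ≤ j ≤ m−1−⌊m/r⌋, 0 ≤ k ≤ r−2−⌊r·j/m⌋ } = { m·k + j : k, j ∈ ℤ, 0 ≤ k ≤ r−2−⌊r/m⌋, 1 ≤ j ≤ m−⌈(k+1)·m/r⌉ }. (Both sets describe the Weierstrass gap set G(Q_i) at a totally ramified finite place of the Kummer extension y^m = ∏_{i=1}^r (x − α_i)^λ with gcd(m, rλ) = 1.) -/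
/-- Two descriptions of the Weierstrass gap set at a totally ramified finite place of a
Kummer extension, for `gcd(m,r) = 1`. -/
theorem gap_set_descriptions_eq (m r : ℕ) (hm : 2 ≤ m) (hr : 1 ≤ r)
    (hcop : Nat.Coprime m r) :
    {x : ℤ | ∃ k j : ℤ,
        1 ≤ j ∧ j ≤ (m : ℤ) - 1 - ⌊(m : ℚ) / (r : ℚ)⌋ ∧
        0 ≤ k ∧ k ≤ (r : ℤ) - 2 - ⌊((r : ℚ) * (j : ℚ)) / (m : ℚ)⌋ ∧
        x = (m : ℤ) * k + j} =
    {x : ℤ | ∃ k j : ℤ,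
        0 ≤ k ∧ k ≤ (r : ℤ) - 2 - ⌊(r : ℚ) / (m : ℚ)⌋ ∧
        1 ≤ j ∧ j ≤ (m : ℤ) - ⌈(((k : ℚ) + 1) * (m : ℚ)) / (r : ℚ)⌉ ∧
        x = (m : ℤ) * k + j} := by
  have hm0 : (0 : ℤ) < m := by omega
  have hr0 : (0 : ℤ) < r := by omega
  have hmq : (0 : ℚ) < m := by exact_mod_cast hm0
  have hrq : (0 : ℚ) < r := by exact_mod_cast hr0
  have floor_m_div_r (j : ℤ) : j ≤ (m : ℤ) - 1 - ⌊(m : ℚ) / r⌋ ↔ (m : ℤ) < (m - j) * r := by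
    rw [show j ≤ (m : ℤ) - 1 - ⌊(m : ℚ) / r⌋ ↔ ⌊(m : ℚ) / r⌋ < m - j by omega,
      Int.floor_lt, div_lt_iff₀ hrq]
    exact_mod_cast Iff.rfl
  have floor_rj_div_m (k j : ℤ) :
      k ≤ (r : ℤ) - 2 - ⌊((r : ℚ) * j) / m⌋ ↔ (r : ℤ) * j < (r - 1 - k) * m := by
    rw [show k ≤ (r : ℤ) - 2 - ⌊((r : ℚ) * j) / m⌋ ↔ ⌊((r : ℚ) * j) / m⌋ < r - 1 - k by omega,
      Int.floor_lt, div_lt_iff₀ hmq]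
    exact_mod_cast Iff.rfl
  have floor_r_div_m (k : ℤ) :
      k ≤ (r : ℤ) - 2 - ⌊(r : ℚ) / m⌋ ↔ (r : ℤ) < (r - 1 - k) * m := by
    simpa using floor_rj_div_m k 1
  have ceil_km_div_r (k j : ℤ) :
      j ≤ (m : ℤ) - ⌈(((k : ℚ) + 1) * m) / r⌉ ↔ (k + 1) * (m : ℤ) ≤ (m - j) * r := by
    rw [show j ≤ (m : ℤ) - ⌈(((k : ℚ) + 1) * m) / r⌉ ↔ ⌈(((k : ℚ) + 1) * m) / r⌉ ≤ m - j by omega,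
      Int.ceil_le, div_le_iff₀ hrq]
    exact_mod_cast Iff.rfl
  ext x
  simp only [Set.mem_ofPred_eq, floor_m_div_r, floor_rj_div_m, floor_r_div_m, ceil_km_div_r]
  constructor
  · rintro ⟨k, j, hj, -, hk, h, rfl⟩
    exact ⟨k, j, hk, by nlinarith, hj, by linarith, rfl⟩
  · rintro ⟨k, j, hk, -, hj, h, rfl⟩
    have hmj : 0 < (m : ℤ) - j := by
      have : 0 < ((m : ℤ) - j) * r := lt_of_lt_of_le (by positivity) h
      exact pos_of_mul_pos_left this hr0.le
    have hne : (k + 1) * (m : ℤ) ≠ (m - j) * r := by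
      intro heq
      have hdvd : (m : ℤ) ∣ m - j :=
        (Nat.isCoprime_iff_coprime.mpr hcop).dvd_of_dvd_mul_right (heq ▸ dvd_mul_left _ _)
      have := Int.le_of_dvd hmj hdvd
      omega
    have hlt := lt_of_le_of_ne h hne
    exact ⟨k, j, hj, by nlinarith, hk, by linarith, rfl⟩
end

section
/- Let r ≥ 1 and u ≥ 1 be integers and set m = u·r + 1. Then the following two sets of integers are equal: { m·k − r·j : k, j ∈ ℤ, 1 ≤ j ≤ m−1−⌊m/r⌋, ⌈r·j/m⌉ ≤ k ≤ r−1 } = { m·k − r·j : k, j ∈ ℤ, 1 ≤ k ≤ r−1, 1 ≤ j ≤ k·u }. (Both sets describe the Weierstrass gap set G(Q_∞) at the infinite place of the Kummer extension y^m = ∏_{i=1}^r (x − α_i)^λ with gcd(m, rλ) = 1, in the case m = ur + 1.) -/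
/-- Two descriptions of the Weierstrass gap set at the infinite place of a Kummer
extension in the case `m = u·r + 1`. -/
theorem infinite_gap_set_descriptions_eq (r u : ℕ) (hr : 1 ≤ r) (hu : 1 ≤ u)
    (m : ℕ) (hm : m = u * r + 1) :
    {x : ℤ | ∃ k j : ℤ,
        1 ≤ j ∧ j ≤ (m : ℤ) - 1 - ⌊(m : ℚ) / (r : ℚ)⌋ ∧
        ⌈((r : ℚ) * (j : ℚ)) / (m : ℚ)⌉ ≤ k ∧ k ≤ (r : ℤ) - 1 ∧
        x = (m : ℤ) * k - (r : ℤ) * j} =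
    {x : ℤ | ∃ k j : ℤ,
        1 ≤ k ∧ k ≤ (r : ℤ) - 1 ∧ 1 ≤ j ∧ j ≤ k * (u : ℤ) ∧
        x = (m : ℤ) * k - (r : ℤ) * j} := by
  have hr0 : (0 : ℚ) < r := by exact_mod_cast hr
  have hm0 : (0 : ℚ) < m := by exact_mod_cast (by omega : 0 < m)
  have hmz : (m : ℤ) = u * r + 1 := by exact_mod_cast hm
  have hrz : (1 : ℤ) ≤ r := by exact_mod_cast hr
  have ceil_le_iff (k j : ℤ) :
      ⌈((r : ℚ) * (j : ℚ)) / (m : ℚ)⌉ ≤ k ↔ (r : ℤ) * j ≤ k * m := by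
    rw [Int.ceil_le, div_le_iff₀ hm0]
    exact_mod_cast Iff.rfl
  ext x
  simp only [Set.mem_ofPred_eq, ceil_le_iff]
  constructor
  · rintro ⟨k, j, hj, -, hjk, hk, hx⟩
    have hk0 : 0 < k := by
      by_contra! h
      nlinarith [mul_nonneg (neg_nonneg.mpr h) (Int.natCast_nonneg m)]
    refine ⟨k, j, hk0, hk, hj, ?_, hx⟩
    by_contra! h
    rw [hmz] at hjk
    nlinarith
  · rintro ⟨k, j, hk0, hk, hj, hjk, hx⟩
    have hfloor : ⌊(m : ℚ) / (r : ℚ)⌋ < (u : ℤ) + 1 := by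
      rw [Int.floor_lt, div_lt_iff₀ hr0]
      have : (m : ℤ) < (u + 1) * r := by rw [hmz]; linarith
      exact_mod_cast this
    refine ⟨k, j, hj, ?_, ?_, hk, hx⟩
    · have := mul_le_mul_of_nonneg_right hk (Int.natCast_nonneg u)
      rw [hmz]
      linarith
    · rw [hmz]
      nlinarith
end

section
/- Suppose in addition that m·v = r + 1 for some integer v ≥ 1, and let 1 ≤ s ≤ r. (a) If 1 ≤ s ≤ r − v − 1, then the set of all arithmetic pure gaps at the indices (0, 1, …, s) equals the union over k = 0, 1, …, r − v − 1 − s of the sets { (m·k_0 + j_0, m·k_1 + j_1, …, m·k_s + j_s) : k_0, …, k_s are nonnegative integers with ∑_{i=0}^{s} k_i = k, and there exists a permutation σ of {0, 1, …, s} such that 1 ≤ j_{σ(i)} ≤ m − ⌈m·(k+i+1)/r⌉ for all 0 ≤ i ≤ s }. (b) If r − v ≤ s ≤ r, then there are no arithmetic pure gaps at (0, 1, …, s). -/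
open Finset

lemma ediv_eq_sub_one_ediv_iff {m : ℤ} (hm : 0 < m) (x : ℤ) :
    x / m = (x - 1) / m ↔ ¬ m ∣ x := by
  have hx := Int.mul_ediv_add_emod x m
  have h0 := Int.emod_nonneg x hm.ne'
  have h1 := Int.emod_lt_of_pos x hm
  rw [Int.dvd_iff_emod_eq_zero, eq_comm, Int.ediv_eq_iff_of_pos hm]
  have hcomm : x / m * m = m * (x / m) := mul_comm _ _
  constructor
  · rintro ⟨h, -⟩ h'
    linarith
  · intro h
    have : 1 ≤ x % m := by omega
    constructor <;> linarith

lemma add_ediv_eq_ite {m : ℤ} (hm : 0 < m) (a u : ℤ) (hu : 0 ≤ u) (hum : u < m) :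
    (a + u) / m = a / m + if m - u ≤ a % m then 1 else 0 := by
  have hx := Int.mul_ediv_add_emod a m
  have h0 := Int.emod_nonneg a hm.ne'
  have h1 := Int.emod_lt_of_pos a hm
  rw [Int.ediv_eq_iff_of_pos hm]
  split_ifs <;> constructor <;> linarith

/-- If `m * v = r + 1`, the value of `gapSum` at `t` only depends on the residue of `t * l`. -/
lemma gapSum_eq {m r s v : ℕ} (hm : 0 < m) {l : ℤ} {lam : Fin (r + 1) → ℤ}
    (hlam : ∀ i : Fin (r + 1), lam i = if i = 0 then -(r : ℤ) * l else l)
    (hmv : m * v = r + 1) (hsr : s ≤ r) (a : Fin (s + 1) → ℤ) (t : ℤ) :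
    gapSum m r (s + 1) lam (fun i => Fin.castLE (Nat.succ_le_succ hsr) i) a t =
      ∑ i, (a i + t * l % m) / m - v * (t * l % m) := by
  have hm' : (m : ℤ) ≠ 0 := by positivity
  have hr : (r : ℤ) = m * v - 1 := by
    have : (m : ℤ) * v = r + 1 := by exact_mod_cast hmv
    linarith
  have htl : t * l = t * l % m + m * (t * l / m) := (Int.emod_add_mul_ediv _ _).symm
  set c : Fin (s + 1) → Fin (r + 1) := fun i => Fin.castLE (Nat.succ_le_succ hsr) i with hc
  set u := t * l % m
  set q := t * l / m
  have hinj : Function.Injective c := Fin.castLE_injective _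
  have hfirst : fdivq m (a 0 + t * lam (c 0)) = (a 0 + u) / m + (-(r : ℤ) * q - v * u) := by
    rw [fdivq_eq_ediv, hlam, if_pos (by simp [hc]), ← Int.add_mul_ediv_left _ _ hm']
    congr 1
    have : t * (-(r : ℤ) * l) = -(r : ℤ) * (t * l) := by ring
    rw [this, htl, hr]
    ring
  have hsucc : ∀ i : Fin s, fdivq m (a i.succ + t * lam (c i.succ)) = (a i.succ + u) / m + q := by
    intro i
    rw [fdivq_eq_ediv, hlam, if_neg (by simp [hc, Fin.ext_iff]), ← Int.add_mul_ediv_left _ _ hm',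
      add_assoc, ← htl]
  have hrest : ∑ w ∈ univ \ image c univ, fdivq m (t * lam w) = ((r : ℤ) - s) * q := by
    have hterm : ∀ w ∈ univ \ image c univ, fdivq m (t * lam w) = q := by
      intro w hw
      have hw0 : w ≠ 0 := by
        rintro rfl
        simp only [mem_sdiff, mem_univ, true_and, mem_image, not_exists] at hw
        exact hw 0 (by simp [hc])
      rw [fdivq_eq_ediv, hlam, if_neg hw0]
    rw [sum_congr rfl hterm, sum_const, card_sdiff_of_subset (subset_univ _),
      card_image_of_injective _ hinj, card_univ, card_univ, Fintype.card_fin, Fintype.card_fin,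
      Nat.add_sub_add_right, nsmul_eq_mul, Nat.cast_sub hsr]
  unfold gapSum
  rw [hrest, Fin.sum_univ_succ, Fin.sum_univ_succ, hfirst, sum_congr rfl fun i _ => hsucc i,
    sum_add_distrib, sum_const, card_univ, Fintype.card_fin, nsmul_eq_mul]
  ring

lemma exists_mul_emod_eq {m : ℕ} {l : ℤ} (hcop : IsCoprime l m) {u : ℤ}
    (hu : 0 ≤ u) (hum : u < m) : ∃ t : ℤ, 0 ≤ t ∧ t ≤ (m : ℤ) - 1 ∧ t * l % m = u := by
  obtain ⟨b, c, hbc⟩ := hcop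
  have hm : (0 : ℤ) < m := hu.trans_lt hum
  refine ⟨u * b % m, Int.emod_nonneg _ hm.ne', Int.le_sub_one_of_lt (Int.emod_lt_of_pos _ hm), ?_⟩
  rw [Int.mul_emod, Int.emod_emod, ← Int.mul_emod]
  have : u * b * l = u + m * (-(u * c)) := by linear_combination u * hbc
  rw [this, Int.add_mul_emod_self_left, Int.emod_eq_of_lt hu hum]

lemma isArithPureGap_iff_forall_residue {m r s v : ℕ} (hm : 0 < m) {l : ℤ}
    (hcop : IsCoprime l m) {lam : Fin (r + 1) → ℤ}
    (hlam : ∀ i : Fin (r + 1), lam i = if i = 0 then -(r : ℤ) * l else l)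
    (hmv : m * v = r + 1) (hsr : s ≤ r) (a : Fin (s + 1) → ℤ) :
    IsArithPureGap m r (s + 1) lam (fun i => Fin.castLE (Nat.succ_le_succ hsr) i) a ↔
      (∀ i, 0 ≤ a i) ∧ ∀ u : ℤ, 0 ≤ u → u < m →
        (∑ i, (a i + u) / m < v * u ∨ ∀ i, ¬ (m : ℤ) ∣ a i + u) := by
  have hm' : (0 : ℤ) < m := by exact_mod_cast hm
  have hlam_dvd : ∀ w, ∀ t : ℤ, (m : ℤ) ∣ t * lam w - t * l % m := by
    intro w t
    have h : (m : ℤ) ∣ t * l - t * l % m := Int.dvd_self_sub_emod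
    have hw : (m : ℤ) ∣ lam w - l := by
      rw [hlam]
      split_ifs
      · refine ⟨-(v * l), ?_⟩
        have : (m : ℤ) * v = r + 1 := by exact_mod_cast hmv
        linear_combination l * this
      · simp
    have := (hw.mul_left t).add h
    ring_nf at this ⊢
    exact this
  have hpoint : ∀ t : ℤ, Xor (gapSum m r (s + 1) lam
        (fun i => Fin.castLE (Nat.succ_le_succ hsr) i) a t < 0)
      (0 ≤ gapSum m r (s + 1) lam (fun i => Fin.castLE (Nat.succ_le_succ hsr) i) a t ∧
        ∀ i : Fin (s + 1), fdivq m (a i + t * lam (Fin.castLE (Nat.succ_le_succ hsr) i)) =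
          fdivq m (a i + t * lam (Fin.castLE (Nat.succ_le_succ hsr) i) - 1)) ↔
      (∑ i, (a i + t * l % m) / m < v * (t * l % m) ∨
        ∀ i, ¬ (m : ℤ) ∣ a i + t * l % m) := by
    intro t
    have hdvd : ∀ i : Fin (s + 1),
        (m : ℤ) ∣ a i + t * lam (Fin.castLE (Nat.succ_le_succ hsr) i) ↔
          (m : ℤ) ∣ a i + t * l % m := by
      intro i
      refine dvd_iff_dvd_of_dvd_sub ?_
      rw [add_sub_add_left_eq_sub]
      exact hlam_dvd _ _
    simp only [fdivq_eq_ediv, ediv_eq_sub_one_ediv_iff hm', hdvd, gapSum_eq hm hlam hmv hsr,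
      sub_neg, Xor, ← not_lt]
    tauto
  refine and_congr_right fun _ => ⟨fun h u hu hum => ?_, fun h t _ _ => ?_⟩
  · obtain ⟨t, ht, htm, rfl⟩ := exists_mul_emod_eq hcop hu hum
    exact (hpoint t).1 (h t ht htm)
  · exact (hpoint t).2 (h _ (Int.emod_nonneg _ hm'.ne') (Int.emod_lt_of_pos _ hm'))

lemma forall_residue_iff_card_lt {m s v : ℕ} (hm : 0 < m) {a : Fin (s + 1) → ℤ}
    (ha : ∀ i, 0 ≤ a i) :
    (∀ u : ℤ, 0 ≤ u → u < m → (∑ i, (a i + u) / m < v * u ∨ ∀ i, ¬ (m : ℤ) ∣ a i + u)) ↔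
      ∀ i, 1 ≤ a i % m ∧
        ∑ x, a x / m + (#{x | a i % m ≤ a x % m} : ℤ) < v * (m - a i % m) := by
  have hm' : (0 : ℤ) < m := by exact_mod_cast hm
  have hsum : ∀ u : ℤ, 0 ≤ u → u < m →
      ∑ i, (a i + u) / m = ∑ x, a x / m + (#{x | (m : ℤ) - u ≤ a x % m} : ℤ) := by
    intro u hu hum
    simp [add_ediv_eq_ite hm' _ u hu hum, sum_add_distrib]
  constructor
  · intro h i
    have hnn := Int.emod_nonneg (a i) hm'.ne'
    have hlt := Int.emod_lt_of_pos (a i) hm'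
    have hpos : 1 ≤ a i % m := by
      rcases h 0 le_rfl hm' with h | h
      · have : 0 ≤ ∑ i, (a i + 0) / (m : ℤ) :=
          sum_nonneg fun i _ => Int.ediv_nonneg (by simpa using ha i) hm'.le
        linarith
      · have := h i
        rw [add_zero, Int.dvd_iff_emod_eq_zero] at this
        omega
    refine ⟨hpos, ?_⟩
    have hdvd : (m : ℤ) ∣ a i + (m - a i % m) := by
      have h : (m : ℤ) ∣ a i - a i % m := Int.dvd_self_sub_emod
      have := h.add (dvd_refl (m : ℤ))
      ring_nf at this ⊢
      exact this
    rcases h (m - a i % m) (by omega) (by omega) with h | h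
    · rw [hsum _ (by omega) (by omega)] at h
      simpa using h
    · exact absurd hdvd (h i)
  · intro h u hu hum
    by_cases hd : ∀ i, ¬ (m : ℤ) ∣ a i + u
    · exact Or.inr hd
    · left
      push Not at hd
      obtain ⟨i, hi⟩ := hd
      obtain ⟨hpos, hcard⟩ := h i
      have hlt := Int.emod_lt_of_pos (a i) hm'
      have hu' : a i % m = m - u := by
        have h1 : (m : ℤ) ∣ a i % m + u := by
          have h2 : (m : ℤ) ∣ a i - a i % m := Int.dvd_self_sub_emod
          have := hi.sub h2
          ring_nf at this ⊢
          exact this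
        obtain ⟨d, hd⟩ := h1
        have hd0 : 0 < d := by nlinarith
        have hd2 : d < 2 := by nlinarith
        obtain rfl : d = 1 := by omega
        linarith
      rw [hsum u hu hum]
      rw [hu'] at hcard
      simpa using hcard

lemma exists_perm_iff_card {n : ℕ} (j : Fin n → ℤ) (f : ℤ → ℤ) (hf : Antitone f) (K : ℤ) :
    (∃ σ : Equiv.Perm (Fin n), ∀ i : Fin n, K + (i : ℕ) + 1 < f (j (σ i))) ↔
      ∀ i, K + (#{x | j i ≤ j x} : ℤ) < f (j i) := by
  constructor
  · rintro ⟨σ, hσ⟩ i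
    have hex : ∃ p : Fin n, j i ≤ j (σ p) ∧ #{x | j i ≤ j x} ≤ (p : ℕ) + 1 := by
      by_contra! hcon
      have hsub : (univ.filter fun x => j i ≤ j x).image (Fin.val ∘ σ.symm) ⊆
          range (#{x | j i ≤ j x} - 1) := by
        intro p hp
        simp only [mem_image, mem_filter, mem_univ, true_and] at hp
        obtain ⟨x, hx, rfl⟩ := hp
        have := hcon (σ.symm x) (by simpa using hx)
        exact mem_range.2 (Nat.lt_sub_of_add_lt this)
      have hle := card_le_card hsub
      rw [card_image_of_injective _ (Fin.val_injective.comp σ.symm.injective), card_range] at hle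
      have : 0 < #{x | j i ≤ j x} := card_pos.2 ⟨i, by simp⟩
      omega
    obtain ⟨p, hp, hcard⟩ := hex
    have := hσ p
    have := hf hp
    have : (#{x | j i ≤ j x} : ℤ) ≤ (p : ℕ) + 1 := by exact_mod_cast hcard
    linarith
  · intro h
    refine ⟨Tuple.sort fun i => -j i, fun i => ?_⟩
    set σ := Tuple.sort fun i => -j i with hσ
    have hmono : Monotone ((fun i => -j i) ∘ σ) := Tuple.monotone_sort _
    have hsub : (Iic i).image σ ⊆ univ.filter fun x => j (σ i) ≤ j x := by
      intro x hx
      obtain ⟨p, hp, rfl⟩ := mem_image.1 hx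
      have := hmono (mem_Iic.1 hp)
      simpa using this
    have hle := card_le_card hsub
    rw [card_image_of_injective _ σ.injective, Fin.card_Iic] at hle
    have := h (σ i)
    have : ((i : ℕ) : ℤ) + 1 ≤ #{x | j (σ i) ≤ j x} := by exact_mod_cast hle
    linarith

lemma le_sub_ceil_iff {m r v : ℕ} (hr : 0 < r) (hmv : m * v = r + 1) {j N : ℤ}
    (hj : 1 ≤ j) (hN : 1 ≤ N) :
    j ≤ (m : ℤ) - ⌈((m : ℚ) * N) / (r : ℚ)⌉ ↔ N < v * (m - j) := by
  have hmv' : (m : ℤ) * v = r + 1 := by exact_mod_cast hmv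
  have hr' : (0 : ℚ) < r := by exact_mod_cast hr
  have hm : (0 : ℤ) < m := by
    have : m ≠ 0 := by
      rintro rfl
      omega
    omega
  have hceil : j ≤ (m : ℤ) - ⌈((m : ℚ) * N) / (r : ℚ)⌉ ↔ (m : ℤ) * N ≤ (m - j) * r := by
    rw [le_sub_comm, Int.ceil_le, div_le_iff₀ hr']
    exact_mod_cast Iff.rfl
  rw [hceil]
  have hid : (m - j) * (r : ℤ) - m * N = m * (v * (m - j) - N) - (m - j) := by
    linear_combination -(m - j) * hmv'
  constructor
  · intro h
    by_contra! hcon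
    have h1 : (0 : ℤ) < m * N := by positivity
    have h2 : 0 < (m : ℤ) - j := by
      by_contra! h3
      nlinarith
    nlinarith
  · intro h
    have : (m : ℤ) * 1 ≤ m * (v * (m - j) - N) := mul_le_mul_of_nonneg_left (by omega) hm.le
    linarith

lemma isArithPureGap_iff_card {m r s v : ℕ} (hm : 0 < m) {l : ℤ}
    (hcop : IsCoprime l m) {lam : Fin (r + 1) → ℤ}
    (hlam : ∀ i : Fin (r + 1), lam i = if i = 0 then -(r : ℤ) * l else l)
    (hmv : m * v = r + 1) (hsr : s ≤ r) (a : Fin (s + 1) → ℤ) :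
    IsArithPureGap m r (s + 1) lam (fun i => Fin.castLE (Nat.succ_le_succ hsr) i) a ↔
      (∀ i, 0 ≤ a i) ∧ (∀ i, 1 ≤ a i % m) ∧ ∃ σ : Equiv.Perm (Fin (s + 1)),
        ∀ i : Fin (s + 1), ∑ x, a x / m + (i : ℕ) + 1 < v * (m - a (σ i) % m) := by
  rw [isArithPureGap_iff_forall_residue hm hcop hlam hmv hsr]
  refine and_congr_right fun ha => ?_
  rw [forall_residue_iff_card_lt hm ha, forall_and]
  refine and_congr_right fun _ => ?_
  have hf : Antitone fun j : ℤ => (v : ℤ) * (m - j) := fun x y hxy =>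
    mul_le_mul_of_nonneg_left (by linarith) (by positivity)
  exact (exists_perm_iff_card (fun i => a i % m) _ hf _).symm

lemma sum_ediv_le_of_isArithPureGap {m r s v : ℕ} (hm : 0 < m) {l : ℤ}
    (hcop : IsCoprime l m) {lam : Fin (r + 1) → ℤ}
    (hlam : ∀ i : Fin (r + 1), lam i = if i = 0 then -(r : ℤ) * l else l)
    (hmv : m * v = r + 1) (hsr : s ≤ r) {a : Fin (s + 1) → ℤ}
    (h : IsArithPureGap m r (s + 1) lam (fun i => Fin.castLE (Nat.succ_le_succ hsr) i) a) :
    ∑ i, a i / m ≤ (r : ℤ) - v - 1 - s := by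
  obtain ⟨-, hpos, σ, hσ⟩ := (isArithPureGap_iff_card hm hcop hlam hmv hsr a).1 h
  have hlast := hσ (Fin.last s)
  have hmv' : (m : ℤ) * v = r + 1 := by exact_mod_cast hmv
  have := mul_le_mul_of_nonneg_left (hpos (σ (Fin.last s))) (Int.natCast_nonneg v)
  rw [Fin.val_last] at hlast
  linarith

/-- Explicit description of the set of pure gaps at the indices `(0,1,…,s)` (including
the infinite place) in the case `m·v = r+1` (Proposition precise_puregap2). -/
theorem pureGaps_with_infinity_description (m r : ℕ) (hm : 2 ≤ m) (hr : 1 ≤ r)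
    (l : ℤ) (hl : l ≠ 0) (hgcd : Int.gcd (m : ℤ) ((r : ℤ) * l) = 1)
    (lam : Fin (r + 1) → ℤ)
    (hlam : ∀ i : Fin (r + 1), lam i = if i = 0 then -(r : ℤ) * l else l)
    (v : ℕ) (hv : 1 ≤ v) (hmv : m * v = r + 1)
    (s : ℕ) (hs1 : 1 ≤ s) (hsr : s ≤ r) :
    ((s : ℤ) ≤ (r : ℤ) - (v : ℤ) - 1 →
      {a : Fin (s + 1) → ℤ | IsArithPureGap m r (s + 1) lam
          (fun i => Fin.castLE (Nat.succ_le_succ hsr) i) a} =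
        {b : Fin (s + 1) → ℤ |
          ∃ (kk jj : Fin (s + 1) → ℤ) (σ : Equiv.Perm (Fin (s + 1))),
            (∀ i, 0 ≤ kk i) ∧
            (∑ i, kk i) ≤ (r : ℤ) - (v : ℤ) - 1 - (s : ℤ) ∧
            (∀ i : Fin (s + 1), 1 ≤ jj (σ i) ∧
              jj (σ i) ≤ (m : ℤ) -
                ⌈((m : ℚ) * (((∑ x, kk x : ℤ) : ℚ) + ((i : ℕ) : ℚ) + 1)) / (r : ℚ)⌉) ∧
            b = fun i => (m : ℤ) * kk i + jj i}) ∧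
    ((r : ℤ) - (v : ℤ) ≤ (s : ℤ) →
      ∀ a : Fin (s + 1) → ℤ, ¬ IsArithPureGap m r (s + 1) lam
        (fun i => Fin.castLE (Nat.succ_le_succ hsr) i) a) := by
  have hm0 : 0 < m := by omega
  have hm' : (0 : ℤ) < m := by exact_mod_cast hm0
  have hcop : IsCoprime l m :=
    (IsCoprime.of_mul_right_right (Int.isCoprime_iff_gcd_eq_one.2 hgcd)).symm
  refine ⟨fun _ => ?_, fun hs a ha => ?_⟩
  · ext a
    simp only [Set.mem_ofPred_eq]
    constructor
    · intro h
      have hsum := sum_ediv_le_of_isArithPureGap hm0 hcop hlam hmv hsr h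
      obtain ⟨ha, hpos, σ, hσ⟩ := (isArithPureGap_iff_card hm0 hcop hlam hmv hsr a).1 h
      have hk : ∀ i, 0 ≤ a i / m := fun i => Int.ediv_nonneg (ha i) hm'.le
      refine ⟨fun i => a i / m, fun i => a i % m, σ, hk, hsum, fun i => ⟨hpos _, ?_⟩,
        funext fun i => (Int.mul_ediv_add_emod _ _).symm⟩
      have hK : 0 ≤ ∑ x, a x / m := sum_nonneg fun i _ => hk i
      have := (le_sub_ceil_iff hr hmv (hpos (σ i)) (by omega)).2 (hσ i)
      push_cast at this ⊢
      exact this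
    · rintro ⟨k, j, σ, hk, -, hj, rfl⟩
      have hK : 0 ≤ ∑ x, k x := sum_nonneg fun i _ => hk i
      have hlt : ∀ i : Fin (s + 1), ∑ x, k x + (i : ℕ) + 1 < v * (m - j (σ i)) := by
        intro i
        refine (le_sub_ceil_iff hr hmv (hj i).1 (by omega)).1 ?_
        have := (hj i).2
        push_cast at this ⊢
        exact this
      have hj1 : ∀ i, 1 ≤ j i := fun i => by simpa using (hj (σ.symm i)).1
      have hjm : ∀ i, j i < m := by
        intro i
        have h := hlt (σ.symm i)
        rw [Equiv.apply_symm_apply] at h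
        by_contra! hcon
        have : (v : ℤ) * (m - j i) ≤ 0 :=
          mul_nonpos_of_nonneg_of_nonpos (by positivity) (by linarith)
        omega
      have hmod : ∀ i, ((m : ℤ) * k i + j i) % m = j i := fun i => by
        rw [Int.mul_add_emod_self_left, Int.emod_eq_of_lt (by linarith [hj1 i]) (hjm i)]
      have hdiv : ∀ i, ((m : ℤ) * k i + j i) / m = k i := fun i => by
        rw [Int.mul_add_ediv_left _ _ hm'.ne', Int.ediv_eq_zero_of_lt (by linarith [hj1 i]) (hjm i),
          add_zero]
      rw [isArithPureGap_iff_card hm0 hcop hlam hmv hsr]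
      simp only [hmod, hdiv]
      exact ⟨fun i => add_nonneg (mul_nonneg hm'.le (hk i)) (by linarith [hj1 i]), hj1, σ, hlt⟩
  · have hsum := sum_ediv_le_of_isArithPureGap hm0 hcop hlam hmv hsr ha
    have : 0 ≤ ∑ i, a i / (m : ℤ) := sum_nonneg fun i _ => Int.ediv_nonneg (ha.1 i) hm'.le
    linarith
end
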